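/- The subgroup of GL(5,ℝ) generated by the four matrices A₁ = (1/2)[[1,1,1,1,0],[1,1,−1,−1,0],[1,−1,1,−1,0],[1,−1,−1,1,0],[0,0,0,0,2]], A₂ = [[1,0,0,0,0],[0,1,0,0,0],[0,0,1,0,0],[0,0,0,−1,0],[0,0,0,0,1]], A₃ = [[1,0,0,0,0],[0,1,0,0,0],[0,0,0,1,0],[0,0,1,0,0],[0,0,0,0,1]], A₄ = [[1,0,0,0,0],[0,0,1,0,0],[0,1,0,0,0],[0,0,0,1,0],[0,0,0,0,1]] is finite of order 1152 (it is the group of symmetries of the regular 24-cell Q centered at (0,0,0,0,1)). -/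

import Mathlib

open Matrix

noncomputable def M1 : Matrix (Fin 5) (Fin 5) ℝ :=
  (1/2 : ℝ) • !![1, 1, 1, 1, 0; 1, 1, -1, -1, 0; 1, -1, 1, -1, 0; 1, -1, -1, 1, 0; 0, 0, 0, 0, 2]

noncomputable def M2 : Matrix (Fin 5) (Fin 5) ℝ :=
  !![1, 0, 0, 0, 0; 0, 1, 0, 0, 0; 0, 0, 1, 0, 0; 0, 0, 0, -1, 0; 0, 0, 0, 0, 1]

noncomputable def M3 : Matrix (Fin 5) (Fin 5) ℝ :=
  !![1, 0, 0, 0, 0; 0, 1, 0, 0, 0; 0, 0, 0, 1, 0; 0, 0, 1, 0, 0; 0, 0, 0, 0, 1]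

noncomputable def M4 : Matrix (Fin 5) (Fin 5) ℝ :=
  !![1, 0, 0, 0, 0; 0, 0, 1, 0, 0; 0, 1, 0, 0, 0; 0, 0, 0, 1, 0; 0, 0, 0, 0, 1]

/-- Twice the 24 vertices. -/
def vz : Fin 24 → Fin 4 → ℤ :=
  ![![2, 0, 0, 0],
    ![0, 2, 0, 0],
    ![0, 0, 2, 0],
    ![0, 0, 0, 2],
    ![-2, 0, 0, 0],
    ![0, -2, 0, 0],
    ![0, 0, -2, 0],
    ![0, 0, 0, -2],
    ![1, 1, 1, 1],
    ![1, 1, 1, -1],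
    ![1, 1, -1, 1],
    ![1, 1, -1, -1],
    ![1, -1, 1, 1],
    ![1, -1, 1, -1],
    ![1, -1, -1, 1],
    ![1, -1, -1, -1],
    ![-1, 1, 1, 1],
    ![-1, 1, 1, -1],
    ![-1, 1, -1, 1],
    ![-1, 1, -1, -1],
    ![-1, -1, 1, 1],
    ![-1, -1, 1, -1],
    ![-1, -1, -1, 1],
    ![-1, -1, -1, -1]]

def act1 : Fin 24 → Fin 24 :=
  ![8, 11, 13, 14, 23, 20, 18, 17, 0, 9, 10, 1, 12, 2, 3, 16, 15, 7, 6, 19, 5, 21, 22, 4]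

def act2 : Fin 24 → Fin 24 :=
  ![0, 1, 2, 7, 4, 5, 6, 3, 9, 8, 11, 10, 13, 12, 15, 14, 17, 16, 19, 18, 21, 20, 23, 22]

def act3 : Fin 24 → Fin 24 :=
  ![0, 1, 3, 2, 4, 5, 7, 6, 8, 10, 9, 11, 12, 14, 13, 15, 16, 18, 17, 19, 20, 22, 21, 23]

def act4 : Fin 24 → Fin 24 :=
  ![0, 2, 1, 3, 4, 6, 5, 7, 8, 9, 12, 13, 10, 11, 14, 15, 16, 17, 20, 21, 18, 19, 22, 23]

def words1 : List (List (Fin 4)) :=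
  [[], [0], [0, 1], [0, 1, 2], [0, 1, 2, 1], [0, 1, 2, 3], [0, 1, 2, 1, 0], [0, 1, 2, 1, 3], [0, 1, 2, 1, 0, 3], [0, 1, 2, 1, 3, 2], [0, 1, 2, 1, 0, 3, 2], [0, 1, 2, 1, 3, 2, 1], [0, 1, 2, 1, 0, 3, 2, 1], [0, 1, 2, 1, 3, 2, 1, 0], [0, 1, 2, 1, 0, 3, 2, 1, 0], [0, 1, 2, 1, 0, 3, 2, 1, 2], [0, 1, 2, 1, 0, 3, 2, 1, 0, 2], [0, 1, 2, 1, 0, 3, 2, 1, 2, 3], [0, 1, 2, 1, 0, 3, 2, 1, 0, 2, 1], [0, 1, 2, 1, 0, 3, 2, 1, 0, 2, 3], [0, 1, 2, 1, 0, 3, 2, 1, 0, 2, 1, 3], [0, 1, 2, 1, 0, 3, 2, 1, 0, 2, 1, 3, 2], [0, 1, 2, 1, 0, 3, 2, 1, 0, 2, 1, 3, 2, 1], [0, 1, 2, 1, 0, 3, 2, 1, 0, 2, 1, 3, 2, 1, 0]]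

def words2 : List (List (Fin 4)) :=
  [[], [3], [3, 2], [3, 2, 1], [3, 2, 1, 2], [3, 2, 1, 2, 3]]

def words3 : List (List (Fin 4)) :=
  [[], [2], [2, 1], [2, 1, 2]]

def words4 : List (List (Fin 4)) :=
  [[], [1]]

def orth (i j : Fin 24) : Bool :=
  decide (vz i 0 * vz j 0 + vz i 1 * vz j 1 + vz i 2 * vz j 2 + vz i 3 * vz j 3 = 0)

theorem act1_inv : Function.Involutive act1 := by unfold Function.Involutive; decide +kernel
theorem act2_inv : Function.Involutive act2 := by unfold Function.Involutive; decide +kernel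
theorem act3_inv : Function.Involutive act3 := by unfold Function.Involutive; decide +kernel
theorem act4_inv : Function.Involutive act4 := by unfold Function.Involutive; decide +kernel

/-- The four generators as permutations of the 24 vertices. -/
def gen : Fin 4 → Equiv.Perm (Fin 24) :=
  ![act1_inv.toPerm, act2_inv.toPerm, act3_inv.toPerm, act4_inv.toPerm]

theorem gen_orth : ∀ k i j, orth (gen k i) (gen k j) = orth i j := by decide +kernel

def actw : List (Fin 4) → Fin 24 → Fin 24
  | [], i => i
  | k :: w, i => gen k (actw w i)

theorem actw_append (w w' : List (Fin 4)) (i : Fin 24) :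
    actw (w ++ w') i = actw w (actw w' i) := by
  induction w with
  | nil => rfl
  | cons k w ih => simp [actw, ih]

theorem actw_orth (w : List (Fin 4)) (i j : Fin 24) :
    orth (actw w i) (actw w j) = orth i j := by
  induction w with
  | nil => rfl
  | cons k w ih => simp [actw, gen_orth, ih]

theorem step1 : ∀ i, ∃ w ∈ words1, actw w i = 0 := by decide +kernel
theorem step2 : ∀ i, orth 0 i = true → ∃ w ∈ words2, actw w 0 = 0 ∧ actw w i = 1 := by
  decide +kernel
theorem step3 : ∀ i, orth 0 i = true → orth 1 i = true →
    ∃ w ∈ words3, actw w 0 = 0 ∧ actw w 1 = 1 ∧ actw w i = 2 := by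
  decide +kernel
theorem step4 : ∀ i, orth 0 i = true → orth 1 i = true → orth 2 i = true →
    ∃ w ∈ words4, actw w 0 = 0 ∧ actw w 1 = 1 ∧ actw w 2 = 2 ∧ actw w i = 3 := by
  decide +kernel

/-- Any orthogonal frame of vertices can be moved to the standard one. -/
theorem frame_trans (i j k l : Fin 24) (hij : orth i j = true) (hik : orth i k = true)
    (hjk : orth j k = true) (hil : orth i l = true) (hjl : orth j l = true)
    (hkl : orth k l = true) :
    ∃ w, actw w i = 0 ∧ actw w j = 1 ∧ actw w k = 2 ∧ actw w l = 3 := by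
  obtain ⟨w1, -, a1⟩ := step1 i
  rw [← actw_orth w1] at hij hik hjk hil hjl hkl
  rw [a1] at hij hik hil
  obtain ⟨w2, -, b1, b2⟩ := step2 _ hij
  rw [← actw_orth w2] at hik hjk hil hjl hkl
  rw [b1] at hik hil
  rw [b2] at hjk hjl
  obtain ⟨w3, -, c1, c2, c3⟩ := step3 _ hik hjk
  rw [← actw_orth w3] at hil hjl hkl
  rw [c1] at hil
  rw [c2] at hjl
  rw [c3] at hkl
  obtain ⟨w4, -, d1, d2, d3, d4⟩ := step4 _ hil hjl hkl
  refine ⟨w4 ++ (w3 ++ (w2 ++ w1)), ?_⟩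
  simp only [actw_append, a1, b1, b2, c1, c2, c3, d1, d2, d3, d4, and_self]

abbrev Quad := (_ : Fin 24) × (_ : Fin 24) × (_ : Fin 24) × Fin 24

def orthTo (i : Fin 24) : Finset (Fin 24) := Finset.univ.filter fun j => orth i j = true
def orthTo2 (i j : Fin 24) : Finset (Fin 24) :=
  Finset.univ.filter fun k => (orth i k && orth j k) = true
def orthTo3 (i j k : Fin 24) : Finset (Fin 24) :=
  Finset.univ.filter fun l => (orth i l && (orth j l && orth k l)) = true

def frames : Finset Quad :=
  Finset.univ.sigma fun i => (orthTo i).sigma fun j => (orthTo2 i j).sigma fun k => orthTo3 i j k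

theorem card1 : ∀ i, (orthTo i).card = 6 := by decide +kernel
theorem card2 : ∀ i j, orth i j = true → (orthTo2 i j).card = 4 := by decide +kernel
theorem card3 : ∀ i j, orth i j = true → ∀ k, (orth i k && orth j k) = true →
    (orthTo3 i j k).card = 2 := by decide +kernel

theorem card_frames : frames.card = 1152 := by
  have e2 : ∀ i, ∀ j ∈ orthTo i, ∑ k ∈ orthTo2 i j, (orthTo3 i j k).card = 8 := by
    intro i j hj
    have hj' : orth i j = true := by simpa [orthTo] using hj
    rw [Finset.sum_congr rfl (g := fun _ => 2), Finset.sum_const, card2 i j hj']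
    · rfl
    · intro k hk
      exact card3 i j hj' k (Finset.mem_filter.1 hk).2
  have e1 : ∀ i, ∑ j ∈ orthTo i, ∑ k ∈ orthTo2 i j, (orthTo3 i j k).card = 48 := by
    intro i
    rw [Finset.sum_congr rfl (e2 i), Finset.sum_const, card1]
    rfl
  simp only [frames, Finset.card_sigma, e1]
  simp

/-- Twice the vertices as real vectors. -/
noncomputable def vr (i : Fin 24) : Fin 5 → ℝ :=
  ![(vz i 0 : ℝ), (vz i 1 : ℝ), (vz i 2 : ℝ), (vz i 3 : ℝ), 0]

theorem vz_inj : ∀ i j, vz i 0 = vz j 0 → vz i 1 = vz j 1 → vz i 2 = vz j 2 → vz i 3 = vz j 3 →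
    i = j := by decide +kernel

theorem vr_inj {i j : Fin 24} (h : vr i = vr j) : i = j := by
  have h0 := congrFun h 0
  have h1 := congrFun h 1
  have h2 := congrFun h 2
  have h3 := congrFun h 3
  simp [vr] at h0 h1 h2 h3
  exact vz_inj i j h0 h1 h2 h3

def e5 : Fin 5 → ℝ := ![0, 0, 0, 0, 1]

theorem rel1 : ∀ i, vz i 0 + vz i 1 + vz i 2 + vz i 3 = 2 * vz (gen 0 i) 0 ∧
    vz i 0 + vz i 1 - vz i 2 - vz i 3 = 2 * vz (gen 0 i) 1 ∧
    vz i 0 - vz i 1 + vz i 2 - vz i 3 = 2 * vz (gen 0 i) 2 ∧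
    vz i 0 - vz i 1 - vz i 2 + vz i 3 = 2 * vz (gen 0 i) 3 := by decide +kernel
theorem rel2 : ∀ i, vz (gen 1 i) 0 = vz i 0 ∧ vz (gen 1 i) 1 = vz i 1 ∧
    vz (gen 1 i) 2 = vz i 2 ∧ vz (gen 1 i) 3 = - vz i 3 := by decide +kernel
theorem rel3 : ∀ i, vz (gen 2 i) 0 = vz i 0 ∧ vz (gen 2 i) 1 = vz i 1 ∧
    vz (gen 2 i) 2 = vz i 3 ∧ vz (gen 2 i) 3 = vz i 2 := by decide +kernel
theorem rel4 : ∀ i, vz (gen 3 i) 0 = vz i 0 ∧ vz (gen 3 i) 1 = vz i 2 ∧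
    vz (gen 3 i) 2 = vz i 1 ∧ vz (gen 3 i) 3 = vz i 3 := by decide +kernel

theorem mul1 (i : Fin 24) : M1 *ᵥ vr i = vr (gen 0 i) := by
  obtain ⟨a, b, c, d⟩ := rel1 i
  have a' := congrArg (Int.cast : ℤ → ℝ) a
  have b' := congrArg (Int.cast : ℤ → ℝ) b
  have c' := congrArg (Int.cast : ℤ → ℝ) c
  have d' := congrArg (Int.cast : ℤ → ℝ) d
  push_cast at a' b' c' d'
  ext t
  fin_cases t <;> simp [M1, vr, mulVec, dotProduct, Fin.sum_univ_five] <;> linarith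

theorem mul2 (i : Fin 24) : M2 *ᵥ vr i = vr (gen 1 i) := by
  obtain ⟨a, b, c, d⟩ := rel2 i
  ext t
  fin_cases t <;> simp [M2, vr, mulVec, dotProduct, Fin.sum_univ_five, a, b, c, d]

theorem mul3 (i : Fin 24) : M3 *ᵥ vr i = vr (gen 2 i) := by
  obtain ⟨a, b, c, d⟩ := rel3 i
  ext t
  fin_cases t <;> simp [M3, vr, mulVec, dotProduct, Fin.sum_univ_five, a, b, c, d]

theorem mul4 (i : Fin 24) : M4 *ᵥ vr i = vr (gen 3 i) := by
  obtain ⟨a, b, c, d⟩ := rel4 i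
  ext t
  fin_cases t <;> simp [M4, vr, mulVec, dotProduct, Fin.sum_univ_five, a, b, c, d]

theorem fix1 : M1 *ᵥ e5 = e5 := by
  ext t
  fin_cases t <;> simp [M1, e5, mulVec, dotProduct, Fin.sum_univ_five]
theorem fix2 : M2 *ᵥ e5 = e5 := by
  ext t
  fin_cases t <;> simp [M2, e5, mulVec, dotProduct, Fin.sum_univ_five]
theorem fix3 : M3 *ᵥ e5 = e5 := by
  ext t
  fin_cases t <;> simp [M3, e5, mulVec, dotProduct, Fin.sum_univ_five]
theorem fix4 : M4 *ᵥ e5 = e5 := by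
  ext t
  fin_cases t <;> simp [M4, e5, mulVec, dotProduct, Fin.sum_univ_five]

/-- `g` permutes the vertices via `s`, fixing the last basis vector. -/
structure Acts (g : GL (Fin 5) ℝ) (s : Equiv.Perm (Fin 24)) : Prop where
  vert : ∀ i, (g : Matrix (Fin 5) (Fin 5) ℝ) *ᵥ vr i = vr (s i)
  last : (g : Matrix (Fin 5) (Fin 5) ℝ) *ᵥ e5 = e5
  pres : ∀ i j, orth (s i) (s j) = orth i j

theorem Acts.one : Acts 1 1 := ⟨by simp, by simp, by simp⟩

theorem Acts.mul {g h : GL (Fin 5) ℝ} {s t : Equiv.Perm (Fin 24)} (hg : Acts g s)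
    (hh : Acts h t) : Acts (g * h) (s * t) := by
  refine ⟨fun i => ?_, ?_, fun i j => ?_⟩
  · rw [Units.val_mul, ← mulVec_mulVec, hh.vert, hg.vert]; rfl
  · rw [Units.val_mul, ← mulVec_mulVec, hh.last, hg.last]
  · rw [Equiv.Perm.mul_apply, Equiv.Perm.mul_apply, hg.pres, hh.pres]

theorem inv_mulVec (g : GL (Fin 5) ℝ) {v w : Fin 5 → ℝ}
    (h : (g : Matrix (Fin 5) (Fin 5) ℝ) *ᵥ v = w) :
    ((g⁻¹ : GL (Fin 5) ℝ) : Matrix (Fin 5) (Fin 5) ℝ) *ᵥ w = v := by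
  rw [← h, mulVec_mulVec, ← Units.val_mul, inv_mul_cancel, Units.val_one, one_mulVec]

theorem Acts.inv {g : GL (Fin 5) ℝ} {s : Equiv.Perm (Fin 24)} (hg : Acts g s) :
    Acts g⁻¹ s⁻¹ := by
  refine ⟨fun i => inv_mulVec g ?_, inv_mulVec g hg.last, fun i j => ?_⟩
  · rw [hg.vert]; simp
  · rw [← hg.pres]; simp

theorem vr_basis (t : Fin 4) : vr (t.castLE (by norm_num)) = Pi.single t.castSucc 2 := by
  ext x
  fin_cases t <;> fin_cases x <;> simp [vr, vz]

theorem e5_eq : e5 = Pi.single 4 1 := by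
  ext x
  fin_cases x <;> simp [e5]

theorem ext_of {g h : Matrix (Fin 5) (Fin 5) ℝ} (h0 : g *ᵥ vr 0 = h *ᵥ vr 0)
    (h1 : g *ᵥ vr 1 = h *ᵥ vr 1) (h2 : g *ᵥ vr 2 = h *ᵥ vr 2) (h3 : g *ᵥ vr 3 = h *ᵥ vr 3)
    (h4 : g *ᵥ e5 = h *ᵥ e5) : g = h := by
  have b0 : vr 0 = Pi.single 0 2 := vr_basis 0
  have b1 : vr 1 = Pi.single 1 2 := vr_basis 1
  have b2 : vr 2 = Pi.single 2 2 := vr_basis 2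
  have b3 : vr 3 = Pi.single 3 2 := vr_basis 3
  rw [b0] at h0
  rw [b1] at h1
  rw [b2] at h2
  rw [b3] at h3
  rw [e5_eq] at h4
  ext x y
  have k0 := congrFun h0 x
  have k1 := congrFun h1 x
  have k2 := congrFun h2 x
  have k3 := congrFun h3 x
  have k4 := congrFun h4 x
  simp at k0 k1 k2 k3 k4
  fin_cases y <;> simp [k0, k1, k2, k3, k4]


theorem stmt16 (A1 A2 A3 A4 : GL (Fin 5) ℝ)
    (h1 : (A1 : Matrix (Fin 5) (Fin 5) ℝ) = M1)
    (h2 : (A2 : Matrix (Fin 5) (Fin 5) ℝ) = M2)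
    (h3 : (A3 : Matrix (Fin 5) (Fin 5) ℝ) = M3)
    (h4 : (A4 : Matrix (Fin 5) (Fin 5) ℝ) = M4) :
    Nat.card (Subgroup.closure {A1, A2, A3, A4} : Subgroup (GL (Fin 5) ℝ)) = 1152 := by
  have g1 : Acts A1 (gen 0) := ⟨by rw [h1]; exact mul1, by rw [h1]; exact fix1, gen_orth 0⟩
  have g2 : Acts A2 (gen 1) := ⟨by rw [h2]; exact mul2, by rw [h2]; exact fix2, gen_orth 1⟩
  have g3 : Acts A3 (gen 2) := ⟨by rw [h3]; exact mul3, by rw [h3]; exact fix3, gen_orth 2⟩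
  have g4 : Acts A4 (gen 3) := ⟨by rw [h4]; exact mul4, by rw [h4]; exact fix4, gen_orth 3⟩
  set G := Subgroup.closure {A1, A2, A3, A4} with hG
  have hgen : ∀ k : Fin 4, ∃ g ∈ G, Acts g (gen k) := by
    intro k
    fin_cases k
    · exact ⟨A1, Subgroup.subset_closure (by simp), g1⟩
    · exact ⟨A2, Subgroup.subset_closure (by simp), g2⟩
    · exact ⟨A3, Subgroup.subset_closure (by simp), g3⟩
    · exact ⟨A4, Subgroup.subset_closure (by simp), g4⟩
  have hact : ∀ g : G, ∃ s, Acts (g : GL (Fin 5) ℝ) s := by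
    rintro ⟨g, hg⟩
    change ∃ s, Acts g s
    induction hg using Subgroup.closure_induction with
    | mem x hx =>
      simp only [Set.mem_insert_iff, Set.mem_singleton_iff] at hx
      rcases hx with rfl | rfl | rfl | rfl
      exacts [⟨_, g1⟩, ⟨_, g2⟩, ⟨_, g3⟩, ⟨_, g4⟩]
    | one => exact ⟨1, Acts.one⟩
    | mul x y _ _ hx hy =>
      obtain ⟨s, hs⟩ := hx
      obtain ⟨t, ht⟩ := hy
      exact ⟨_, hs.mul ht⟩
    | inv x _ hx =>
      obtain ⟨s, hs⟩ := hx
      exact ⟨_, hs.inv⟩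
  choose s hs using hact
  have hword : ∀ w : List (Fin 4), ∃ g ∈ G, ∃ t, Acts g t ∧ ∀ i, t i = actw w i := by
    intro w
    induction w with
    | nil => exact ⟨1, one_mem _, 1, Acts.one, fun i => rfl⟩
    | cons k w ih =>
      obtain ⟨g, hg, t, ht, e⟩ := ih
      obtain ⟨a, ha, hk⟩ := hgen k
      exact ⟨a * g, mul_mem ha hg, gen k * t, hk.mul ht, fun i => by
        rw [Equiv.Perm.mul_apply, e]; rfl⟩
  let f : G → Quad := fun g => ⟨s g 0, s g 1, s g 2, s g 3⟩
  have hf : Function.Injective f := by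
    intro g h e
    have e0 : s g 0 = s h 0 := congrArg (fun q : Quad => q.1) e
    have e1 : s g 1 = s h 1 := congrArg (fun q : Quad => q.2.1) e
    have e2 : s g 2 = s h 2 := congrArg (fun q : Quad => q.2.2.1) e
    have e3 : s g 3 = s h 3 := congrArg (fun q : Quad => q.2.2.2) e
    apply Subtype.ext
    apply Units.ext
    apply ext_of
    · rw [(hs g).vert, (hs h).vert, e0]
    · rw [(hs g).vert, (hs h).vert, e1]
    · rw [(hs g).vert, (hs h).vert, e2]
    · rw [(hs g).vert, (hs h).vert, e3]
    · rw [(hs g).last, (hs h).last]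
  have hr : Set.range f = (frames : Set Quad) := by
    ext ⟨i, j, k, l⟩
    constructor
    · rintro ⟨g, hg⟩
      rw [← hg]
      have o := (hs g).pres
      have b : orth 0 1 = true ∧ orth 0 2 = true ∧ orth 0 3 = true ∧ orth 1 2 = true ∧
        orth 1 3 = true ∧ orth 2 3 = true := by decide +kernel
      simp [f, frames, orthTo, orthTo2, orthTo3, o, b]
    · intro h
      simp [frames, orthTo, orthTo2, orthTo3] at h
      obtain ⟨hij, ⟨hik, hjk⟩, hil, hjl, hkl⟩ := h
      obtain ⟨w, p0, p1, p2, p3⟩ := frame_trans i j k l hij hik hjk hil hjl hkl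
      obtain ⟨g, hg, t, ht, e⟩ := hword w
      have key : ∀ x y, actw w x = y → s ⟨g⁻¹, inv_mem hg⟩ y = x := by
        intro x y hxy
        apply vr_inj
        rw [← (hs ⟨g⁻¹, inv_mem hg⟩).vert, ← hxy, ← e]
        exact inv_mulVec g (ht.vert x)
      refine ⟨⟨g⁻¹, inv_mem hg⟩, ?_⟩
      simp only [f, key _ _ p0, key _ _ p1, key _ _ p2, key _ _ p3]
  rw [Nat.card_congr (Equiv.ofInjective f hf), hr]
  rw [Nat.card_coe_set_eq, Set.ncard_coe_finset, card_frames]
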